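/- arXiv:1309.3461 — 3 statements merged into one kernel-verified Lean document; each statement's English description precedes it below -/
import Mathlib

section
/- Let Δ > 0 and η ∈ (0,1), and let u_Δ be the Δ-periodic on-and-off signal with split η. Then for every t ≥ 0 one has 0 ≤ ∫₀ᵗ u_Δ(τ) dτ − η t ≤ η(1−η)Δ; in particular |∫₀ᵗ u_Δ(τ) dτ − η t| ≤ η(1−η)Δ ≤ Δ/4, with η(1−η) = 1/4 if and only if η = 1/2. -/
/-- The Δ-periodic on-and-off traffic signal with split η: equal to 1 (green)
during the first ηΔ of each cycle of length Δ, and 0 (red) otherwise. -/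
noncomputable def uOnOff (Δ η τ : ℝ) : ℝ :=
  if τ - Δ * (⌊τ / Δ⌋ : ℝ) < η * Δ then 1 else 0

theorem uOnOff_periodic {Δ : ℝ} (hΔ : Δ ≠ 0) (η : ℝ) : Function.Periodic (uOnOff Δ η) Δ := by
  intro τ
  have h : (τ + Δ) / Δ = τ / Δ + 1 := by field_simp
  have h' : τ + Δ - Δ * ((⌊τ / Δ⌋ : ℝ) + 1) = τ - Δ * (⌊τ / Δ⌋ : ℝ) := by ring
  simp only [uOnOff, h, Int.floor_add_one, Int.cast_add, Int.cast_one, h']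

theorem uOnOff_eq_ite {Δ τ : ℝ} (η : ℝ) (h0 : 0 ≤ τ) (h1 : τ < Δ) :
    uOnOff Δ η τ = if τ < η * Δ then 1 else 0 := by
  have hΔ : 0 < Δ := h0.trans_lt h1
  have h : ⌊τ / Δ⌋ = 0 :=
    Int.floor_eq_zero_iff.2 ⟨div_nonneg h0 hΔ.le, (div_lt_one hΔ).2 h1⟩
  simp [uOnOff, h]

theorem measurable_uOnOff (Δ η : ℝ) : Measurable (uOnOff Δ η) := by
  unfold uOnOff
  refine Measurable.ite (measurableSet_lt ?_ measurable_const) measurable_const measurable_const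
  fun_prop

theorem intervalIntegrable_uOnOff (Δ η a b : ℝ) :
    IntervalIntegrable (uOnOff Δ η) MeasureTheory.volume a b := by
  refine (intervalIntegrable_const (c := (1 : ℝ))).mono_fun
    (measurable_uOnOff Δ η).aestronglyMeasurable (Filter.Eventually.of_forall fun τ => ?_)
  unfold uOnOff
  beta_reduce
  split_ifs <;> simp

/-- Within the first cycle, the accumulated green time is `min s (ηΔ)`. -/
theorem integral_uOnOff_of_le {Δ η s : ℝ} (hη : 0 ≤ η) (hs : 0 ≤ s) (hsΔ : s ≤ Δ) :
    ∫ τ in (0 : ℝ)..s, uOnOff Δ η τ = min s (η * Δ) := by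
  have green {r : ℝ} (hr : 0 ≤ r) (hrs : r ≤ s) (hrη : r ≤ η * Δ) :
      ∫ τ in (0 : ℝ)..r, uOnOff Δ η τ = r := by
    rw [intervalIntegral.integral_congr_Ioo_of_le (g := fun _ => 1) hr]
    · simp
    · intro τ hτ
      simp only
      rw [uOnOff_eq_ite η hτ.1.le (by linarith [hτ.2]), if_pos (by linarith [hτ.2])]
  rcases le_total s (η * Δ) with h | h
  · rw [min_eq_left h, green hs le_rfl h]
  · have hηΔ : 0 ≤ η * Δ := mul_nonneg hη (hs.trans hsΔ)
    have red : ∫ τ in (η * Δ)..s, uOnOff Δ η τ = 0 := by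
      rw [intervalIntegral.integral_congr_Ioo_of_le (g := fun _ => 0) h]
      · simp
      · intro τ hτ
        simp only
        rw [uOnOff_eq_ite η (by linarith [hτ.1]) (by linarith [hτ.2]), if_neg (by linarith [hτ.1])]
    rw [min_eq_right h, ← intervalIntegral.integral_add_adjacent_intervals
      (intervalIntegrable_uOnOff Δ η 0 (η * Δ)) (intervalIntegrable_uOnOff Δ η (η * Δ) s),
      red, green hηΔ h le_rfl, add_zero]

theorem integral_uOnOff_cycles_add {Δ η s : ℝ} (hΔ : 0 < Δ) (hη : η ∈ Set.Icc (0 : ℝ) 1)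
    (hs : 0 ≤ s) (hsΔ : s ≤ Δ) (n : ℤ) :
    ∫ τ in (0 : ℝ)..(n * Δ + s), uOnOff Δ η τ = n * (η * Δ) + min s (η * Δ) := by
  have hper := uOnOff_periodic hΔ.ne' η
  have cycles : ∫ τ in (0 : ℝ)..(n * Δ), uOnOff Δ η τ = n * (η * Δ) := by
    have h := hper.intervalIntegral_add_zsmul_eq n 0
      (fun a b => intervalIntegrable_uOnOff Δ η a b)
    simpa [integral_uOnOff_of_le hη.1 hΔ.le le_rfl,
      min_eq_right (mul_le_of_le_one_left hΔ.le hη.2)] using h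
  have rest : ∫ τ in (n * Δ)..(n * Δ + s), uOnOff Δ η τ = min s (η * Δ) := by
    rw [← integral_uOnOff_of_le hη.1 hs hsΔ]
    have h := intervalIntegral.integral_comp_add_right (a := 0) (b := s) (uOnOff Δ η) (n * Δ)
    simp only [hper.int_mul n _, zero_add] at h
    rw [h, add_comm s]
  rw [← intervalIntegral.integral_add_adjacent_intervals
    (intervalIntegrable_uOnOff Δ η 0 (n * Δ)) (intervalIntegrable_uOnOff Δ η _ _), cycles, rest]

/-- For every `t ≥ 0`, `0 ≤ ∫₀ᵗ u_Δ − η t ≤ η(1−η)Δ`; in particular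
`|∫₀ᵗ u_Δ − η t| ≤ η(1−η)Δ ≤ Δ/4`, with `η(1−η) = 1/4` iff `η = 1/2`. -/
theorem onOff_integral_bound (Δ η : ℝ) (hΔ : 0 < Δ) (hη : η ∈ Set.Ioo (0:ℝ) 1)
    (t : ℝ) (ht : 0 ≤ t) :
    (0 ≤ (∫ τ in (0:ℝ)..t, uOnOff Δ η τ) - η * t ∧
      (∫ τ in (0:ℝ)..t, uOnOff Δ η τ) - η * t ≤ η * (1 - η) * Δ) ∧
    |(∫ τ in (0:ℝ)..t, uOnOff Δ η τ) - η * t| ≤ η * (1 - η) * Δ ∧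
    η * (1 - η) * Δ ≤ Δ / 4 ∧
    (η * (1 - η) = 1 / 4 ↔ η = 1 / 2) := by
  obtain ⟨h0, h1⟩ := hη
  have key : 0 ≤ (∫ τ in (0:ℝ)..t, uOnOff Δ η τ) - η * t ∧
      (∫ τ in (0:ℝ)..t, uOnOff Δ η τ) - η * t ≤ η * (1 - η) * Δ := by
    obtain ⟨n, s, hs, hsΔ, rfl⟩ : ∃ (n : ℤ) (s : ℝ), 0 ≤ s ∧ s ≤ Δ ∧ t = n * Δ + s := by
      refine ⟨⌊t / Δ⌋, t - ⌊t / Δ⌋ * Δ, ?_, ?_, by ring⟩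
      · linarith [(le_div_iff₀ hΔ).1 (Int.floor_le (t / Δ))]
      · linarith [(div_lt_iff₀ hΔ).1 (Int.lt_floor_add_one (t / Δ))]
    rw [integral_uOnOff_cycles_add hΔ ⟨h0.le, h1.le⟩ hs hsΔ]
    rcases le_total s (η * Δ) with h | h
    · rw [min_eq_left h]
      constructor <;> nlinarith
    · rw [min_eq_right h]
      constructor <;> nlinarith
  refine ⟨key, ?_, ?_, ?_⟩
  · rw [abs_of_nonneg key.1]
    exact key.2
  · nlinarith [mul_nonneg hΔ.le (sq_nonneg (η - 1 / 2))]
  · constructor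
    · intro h
      have : (η - 1 / 2) ^ 2 = 0 := by linarith
      linarith [pow_eq_zero_iff two_ne_zero |>.1 this]
    · rintro rfl
      norm_num
end

section
/- Let f be a fundamental diagram with wave-speed bounds v and w, T > 0, a < b, and let 𝒞₁, 𝒞₂ : [0,T]×[a,b] → ℝ ∪ {+∞} be two value conditions that coincide at every point of [0,T]×[a,b] except possibly at points of the downstream boundary {(s,b) : 0 < s ≤ T}. Then the Lax-Hopf episolutions coincide on the region not influenced by the downstream boundary: N_{𝒞₁}(t,x) = N_{𝒞₂}(t,x) for every (t,x) ∈ [0,T]×[a,b] with x ≤ b − wt. -/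
open Set

/-- The concave conjugate `f*(u) = sup_{ρ ∈ [0,ρ_j]} (f(ρ) − uρ)` of a fundamental
diagram `f` with jam density `ρ_j`. -/
noncomputable def concConj (f : ℝ → ℝ) (ρj u : ℝ) : ℝ :=
  sSup ((fun ρ => f ρ - u * ρ) '' Set.Icc 0 ρj)

/-- The generalized Lax-Hopf viability episolution on `[0,T] × [a,b]` associated with a
value condition `𝒞 : [0,T]×[a,b] → ℝ ∪ {+∞}` (encoded as an `EReal`-valued function). -/
noncomputable def laxHopf (fs : ℝ → ℝ) (v w T a b : ℝ) (𝒞 : ℝ → ℝ → EReal)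
    (t x : ℝ) : EReal :=
  sInf { z : EReal | ∃ u τ : ℝ, u ∈ Set.Icc (-w) v ∧ 0 ≤ τ ∧
    (t - τ) ∈ Set.Icc 0 T ∧ (x - τ * u) ∈ Set.Icc a b ∧
    z = 𝒞 (t - τ) (x - τ * u) + ((τ * fs u : ℝ) : EReal) }

/-- A characteristic of speed `u ≥ -w` ending at a point with `x ≤ b - w * t` can only emanate
from the downstream boundary `y = b` at a nonpositive time. -/
theorem not_downstream_of_le {w b t x u τ : ℝ} (hw : 0 < w) (hu : -w ≤ u) (hτ : 0 ≤ τ)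
    (hx : x ≤ b - w * t) : ¬(x - τ * u = b ∧ 0 < t - τ) := by
  rintro ⟨hb, hs⟩
  nlinarith [mul_pos hw hs, mul_le_mul_of_nonneg_left hu hτ]

/-- If two value conditions agree everywhere except possibly on the downstream boundary
`{(s,b) : 0 < s ≤ T}`, then their Lax-Hopf episolutions coincide on the region
`x ≤ b − wt` not influenced by the downstream boundary. -/
theorem laxHopf_eq_of_eq_off_downstream
    -- the fundamental diagram
    (ρj : ℝ) (hρj : 0 < ρj) (f : ℝ → ℝ)
    (hfc : ContinuousOn f (Set.Icc 0 ρj)) (hconc : ConcaveOn ℝ (Set.Icc 0 ρj) f)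
    (hf0 : f 0 = 0) (hfρj : f ρj = 0)
    -- wave speeds: right derivative of f at 0 and minus the left derivative at ρ_j
    (v w : ℝ) (hv : 0 < v) (hw : 0 < w)
    (hv' : HasDerivWithinAt f v (Set.Ici 0) 0)
    (hw' : HasDerivWithinAt f (-w) (Set.Iic ρj) ρj)
    -- the domain
    (T a b : ℝ) (hT : 0 < T) (hab : a < b)
    -- value conditions coinciding off the downstream boundary
    (𝒞₁ 𝒞₂ : ℝ → ℝ → EReal)
    (heq : ∀ s y, s ∈ Set.Icc 0 T → y ∈ Set.Icc a b → ¬(y = b ∧ 0 < s) →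
      𝒞₁ s y = 𝒞₂ s y) :
    ∀ t x, t ∈ Set.Icc 0 T → x ∈ Set.Icc a b → x ≤ b - w * t →
      laxHopf (concConj f ρj) v w T a b 𝒞₁ t x =
        laxHopf (concConj f ρj) v w T a b 𝒞₂ t x := by
  intro t x _ _ hxt
  unfold laxHopf
  congr 1
  ext z
  refine exists_congr fun u => exists_congr fun τ => ?_
  refine and_congr_right fun hu => and_congr_right fun hτ => and_congr_right fun hs =>
    and_congr_right fun hy => ?_
  rw [heq _ _ hs hy (not_downstream_of_le hw hu.1 hτ hxt)]
end

section
/- (Bound on supply jumps, Greenshields case.) Let v₀, ρ_j, L > 0, t₀ ∈ ℝ, and let φ(t) = f((f')⁻¹(−L/(t−t₀))) = v₀ρ_j/4 − ρ_j L²/(4v₀(t−t₀)²) for t ≥ t₀ + L/v₀, where f is the Greenshields fundamental diagram with free-flow speed v₀ and jam density ρ_j. Then for every t₁ ≥ t₀ + L/v₀ and every Δ_B ≥ 0, φ(t₁ + Δ_B) − φ(t₁) ≤ φ(t₀ + L/v₀ + Δ_B) = ρ_j v₀² Δ_B (2L + v₀Δ_B) / (4 (L + v₀Δ_B)²). In particular,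 this quantity tends to 0 as Δ_B → 0⁺. -/
open Filter

/-- The decrement of `x ↦ 1 / x ^ 2` over an interval of fixed length is antitone in the left
endpoint. -/
theorem one_div_sq_sub_one_div_add_sq_le {a s d : ℝ} (ha : 0 < a) (has : a ≤ s) (hd : 0 ≤ d) :
    1 / s ^ 2 - 1 / (s + d) ^ 2 ≤ 1 / a ^ 2 - 1 / (a + d) ^ 2 := by
  have key : ∀ x : ℝ, 0 < x →
      1 / x ^ 2 - 1 / (x + d) ^ 2 = d / (x * (x + d)) * (1 / x + 1 / (x + d)) := by
    intro x hx
    have hxd : x + d ≠ 0 := by positivity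
    field_simp
    ring
  have hs : 0 < s := ha.trans_le has
  rw [key s hs, key a ha]
  gcongr

/-- **Bound on supply jumps, Greenshields case.** For the rarefaction flow
`φ(t) = v₀ρ_j/4 − ρ_jL²/(4v₀(t−t₀)²)` at the entrance of a congested Greenshields link,
the increase of `φ` over any interval of length `Δ_B` inside `[t₀ + L/v₀, ∞)` is bounded
by `φ(t₀ + L/v₀ + Δ_B) = ρ_jv₀²Δ_B(2L + v₀Δ_B)/(4(L + v₀Δ_B)²)`, and this bound tends
to `0` as `Δ_B → 0⁺`. -/
theorem greenshields_supply_jump_bound (v₀ ρj L t₀ : ℝ)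
    (hv₀ : 0 < v₀) (hρj : 0 < ρj) (hL : 0 < L)
    (φ : ℝ → ℝ)
    (hφ : ∀ t, φ t = v₀ * ρj / 4 - ρj * L ^ 2 / (4 * v₀ * (t - t₀) ^ 2)) :
    (∀ t₁, t₀ + L / v₀ ≤ t₁ → ∀ Δ_B : ℝ, 0 ≤ Δ_B →
      φ (t₁ + Δ_B) - φ t₁ ≤ φ (t₀ + L / v₀ + Δ_B) ∧
      φ (t₀ + L / v₀ + Δ_B) =
        ρj * v₀ ^ 2 * Δ_B * (2 * L + v₀ * Δ_B) / (4 * (L + v₀ * Δ_B) ^ 2)) ∧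
    Tendsto (fun Δ_B : ℝ =>
        ρj * v₀ ^ 2 * Δ_B * (2 * L + v₀ * Δ_B) / (4 * (L + v₀ * Δ_B) ^ 2))
      (nhdsWithin 0 (Set.Ioi 0)) (nhds 0) := by
  refine ⟨fun t₁ ht₁ d hd => ?_, ?_⟩
  · have ha : 0 < L / v₀ := by positivity
    have hφ_add : ∀ s, φ (t₀ + s) =
        v₀ * ρj / 4 - ρj * L ^ 2 / (4 * v₀) * (1 / s ^ 2) := by
      intro s
      rw [hφ, add_sub_cancel_left, mul_one_div, div_div]
    refine ⟨?_, ?_⟩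
    · have hstart : ρj * L ^ 2 / (4 * v₀) * (1 / (L / v₀) ^ 2) = v₀ * ρj / 4 := by
        field_simp
      have hmono := mul_le_mul_of_nonneg_left
        (one_div_sq_sub_one_div_add_sq_le ha (le_sub_iff_add_le'.mpr ht₁) hd)
        (show 0 ≤ ρj * L ^ 2 / (4 * v₀) by positivity)
      have h₁ := hφ_add (t₁ - t₀)
      have h₂ := hφ_add (t₁ - t₀ + d)
      rw [add_sub_cancel] at h₁
      rw [← add_assoc, add_sub_cancel] at h₂
      rw [add_assoc, hφ_add, h₁, h₂]
      linarith
    · have hd' : L + v₀ * d ≠ 0 := by positivity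
      have hsum : L / v₀ + d = (L + v₀ * d) / v₀ := by field_simp
      rw [add_assoc, hφ_add, hsum]
      field_simp
      ring
  · have hcont : ContinuousAt (fun d : ℝ =>
        ρj * v₀ ^ 2 * d * (2 * L + v₀ * d) / (4 * (L + v₀ * d) ^ 2)) 0 :=
      ContinuousAt.div (by fun_prop) (by fun_prop) (by simp [hL.ne'])
    simpa using hcont.tendsto.mono_left nhdsWithin_le_nhds
end
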